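/- arXiv:1301.2165 — 5 statements merged into one kernel-verified Lean document; each statement's English description precedes it below -/
import Mathlib

section
/- Let q be a prime power, k ≤ n−k positive integers, and let A, B ∈ F_q^{k×(n−k)}. Then the subspace distance between the liftings of A and B satisfies d_S(rowspace[I_k A], rowspace[I_k B]) = 2·rank(A − B). -/
/-- Subspace distance `d_S(U,V) = dim U + dim V - 2 dim (U ∩ V)`. -/
noncomputable def sDist {F : Type*} [Field F] {n : ℕ}
    (U V : Submodule F (Fin n → F)) : ℕ :=
  Module.finrank F U + Module.finrank F V - 2 * Module.finrank F ↥(U ⊓ V)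

/-- Row space of a matrix: the span of its rows. -/
def rowSpace {F : Type*} [Field F] {k n : ℕ} (M : Matrix (Fin k) (Fin n) F) :
    Submodule F (Fin n → F) :=
  Submodule.span F (Set.range fun i : Fin k => M i)

/-- The lifting `[I_k  A]` of a `k × (n-k)` matrix `A`, as a `k × n` matrix. -/
def liftMat {F : Type*} [Field F] {k n : ℕ} (hkn : k ≤ n)
    (A : Matrix (Fin k) (Fin (n - k)) F) : Matrix (Fin k) (Fin n) F :=
  fun i j =>
    if h : (j : ℕ) < k then (if (j : ℕ) = (i : ℕ) then 1 else 0)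
    else A i ⟨(j : ℕ) - k, by have := j.isLt; omega⟩

theorem rowSpace_eq_range_vecMulLinear {F : Type*} [Field F] {k n : ℕ}
    (M : Matrix (Fin k) (Fin n) F) : rowSpace M = LinearMap.range M.vecMulLinear :=
  (range_vecMulLinear M).symm

theorem vecMul_liftMat_of_lt {F : Type*} [Field F] {k n : ℕ} (hkn : k ≤ n)
    (A : Matrix (Fin k) (Fin (n - k)) F) (v : Fin k → F) (i : Fin k) :
    Matrix.vecMul v (liftMat hkn A) (Fin.castLE hkn i) = v i := by
  simp [Matrix.vecMul, dotProduct, liftMat, Fin.val_inj]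

theorem vecMul_liftMat_of_ge {F : Type*} [Field F] {k n : ℕ} (hkn : k ≤ n)
    (A : Matrix (Fin k) (Fin (n - k)) F) (v : Fin k → F) (j : Fin n) (hj : ¬ (j : ℕ) < k) :
    Matrix.vecMul v (liftMat hkn A) j =
      Matrix.vecMul v A ⟨(j : ℕ) - k, by have := j.isLt; omega⟩ := by
  simp [Matrix.vecMul, dotProduct, liftMat, hj]

theorem vecMul_liftMat_eq_iff {F : Type*} [Field F] {k n : ℕ} (hkn : k ≤ n)
    (A B : Matrix (Fin k) (Fin (n - k)) F) (v w : Fin k → F) :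
    Matrix.vecMul v (liftMat hkn A) = Matrix.vecMul w (liftMat hkn B) ↔
      v = w ∧ Matrix.vecMul v A = Matrix.vecMul w B := by
  constructor
  · intro h
    refine ⟨funext fun i => ?_, funext fun j => ?_⟩
    · simpa only [vecMul_liftMat_of_lt] using congrFun h (Fin.castLE hkn i)
    · have hj : (j : ℕ) + k < n := by have := j.isLt; omega
      have hk : ¬ (j : ℕ) + k < k := by omega
      have := congrFun h ⟨(j : ℕ) + k, hj⟩
      rw [vecMul_liftMat_of_ge hkn A v _ hk, vecMul_liftMat_of_ge hkn B w _ hk] at this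
      simpa using this
  · rintro ⟨rfl, h⟩
    funext j
    by_cases hj : (j : ℕ) < k
    · exact (vecMul_liftMat_of_lt hkn A v ⟨j, hj⟩).trans
        (vecMul_liftMat_of_lt hkn B v ⟨j, hj⟩).symm
    · rw [vecMul_liftMat_of_ge hkn A v j hj, vecMul_liftMat_of_ge hkn B v j hj, h]

theorem vecMulLinear_liftMat_injective {F : Type*} [Field F] {k n : ℕ} (hkn : k ≤ n)
    (A : Matrix (Fin k) (Fin (n - k)) F) :
    Function.Injective (liftMat hkn A).vecMulLinear :=
  fun v w h => ((vecMul_liftMat_eq_iff hkn A A v w).1 h).1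

theorem finrank_rowSpace_liftMat {F : Type*} [Field F] {k n : ℕ} (hkn : k ≤ n)
    (A : Matrix (Fin k) (Fin (n - k)) F) :
    Module.finrank F (rowSpace (liftMat hkn A)) = k := by
  rw [rowSpace_eq_range_vecMulLinear,
    LinearMap.finrank_range_of_inj (vecMulLinear_liftMat_injective hkn A), Module.finrank_fin_fun]

theorem rowSpace_liftMat_inf {F : Type*} [Field F] {k n : ℕ} (hkn : k ≤ n)
    (A B : Matrix (Fin k) (Fin (n - k)) F) :
    rowSpace (liftMat hkn A) ⊓ rowSpace (liftMat hkn B) =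
      (LinearMap.ker (A - B).vecMulLinear).map (liftMat hkn A).vecMulLinear := by
  ext x
  simp only [rowSpace_eq_range_vecMulLinear, Submodule.mem_inf, LinearMap.mem_range,
    Submodule.mem_map, LinearMap.mem_ker, Matrix.vecMulLinear_apply, Matrix.vecMul_sub, sub_eq_zero]
  constructor
  · rintro ⟨⟨v, rfl⟩, w, hw⟩
    obtain ⟨rfl, h⟩ := (vecMul_liftMat_eq_iff hkn B A w v).1 hw
    exact ⟨w, h.symm, rfl⟩
  · rintro ⟨v, hv, rfl⟩
    exact ⟨⟨v, rfl⟩, v, (vecMul_liftMat_eq_iff hkn B A v v).2 ⟨rfl, hv.symm⟩⟩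

theorem rank_add_finrank_rowSpace_liftMat_inf {F : Type*} [Field F] {k n : ℕ} (hkn : k ≤ n)
    (A B : Matrix (Fin k) (Fin (n - k)) F) :
    (A - B).rank +
      Module.finrank F ↥(rowSpace (liftMat hkn A) ⊓ rowSpace (liftMat hkn B)) = k := by
  rw [rowSpace_liftMat_inf,
    LinearEquiv.finrank_eq (Submodule.equivMapOfInjective _
      (vecMulLinear_liftMat_injective hkn A) _).symm,
    Matrix.rank_eq_finrank_span_row, ← range_vecMulLinear,
    LinearMap.finrank_range_add_finrank_ker, Module.finrank_fin_fun]

/-- for `A, B ∈ F_q^{k×(n-k)}`,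
`d_S(rowspace [I_k A], rowspace [I_k B]) = 2 · rank (A - B)`. -/
theorem subspace_distance_of_liftings_eq_twice_rank
    {F : Type*} [Field F] [Fintype F] {k n : ℕ} (hk : 0 < k) (hkn : k ≤ n - k)
    (A B : Matrix (Fin k) (Fin (n - k)) F) :
    sDist (rowSpace (liftMat (hkn.trans (Nat.sub_le n k)) A))
        (rowSpace (liftMat (hkn.trans (Nat.sub_le n k)) B)) = 2 * (A - B).rank := by
  have h := rank_add_finrank_rowSpace_liftMat_inf (hkn.trans (Nat.sub_le n k)) A B
  rw [sDist, finrank_rowSpace_liftMat, finrank_rowSpace_liftMat]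
  omega
end

section
/- Let C ⊆ F_q^{k×ℓ} be an F_q-linear subspace such that every nonzero matrix in C has rank at least δ (with 1 ≤ δ ≤ min{k,ℓ}). Then dim_{F_q} C ≤ min{ k(ℓ−δ+1), ℓ(k−δ+1) }. -/
/-- Discarding `δ - 1` of the columns is injective on a linear rank-metric code of minimum
distance `δ`, which bounds the dimension of the code. -/
theorem finrank_le_of_forall_le_rank {F : Type*} [Field F] {k ℓ δ : ℕ}
    (hδ1 : 1 ≤ δ) (hδ : δ ≤ ℓ) (C : Submodule F (Matrix (Fin k) (Fin ℓ) F))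
    (hmin : ∀ A ∈ C, A ≠ 0 → δ ≤ A.rank) :
    Module.finrank F C ≤ k * (ℓ - δ + 1) := by
  have hle : ℓ - δ + 1 ≤ ℓ := by omega
  let φ : C →ₗ[F] Matrix (Fin k) (Fin (ℓ - δ + 1)) F :=
    { toFun := fun A => A.1.submatrix id (Fin.castLE hle)
      map_add' := fun _ _ => rfl
      map_smul' := fun _ _ => rfl }
  have hφ : Function.Injective φ := by
    rw [← LinearMap.ker_eq_bot, LinearMap.ker_eq_bot']
    rintro ⟨A, hA⟩ h
    by_contra hne
    have hA0 : A ≠ 0 := fun h0 => hne (Subtype.ext h0)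
    have hzero : ∀ (i : Fin k) (j : Fin ℓ), (j : ℕ) < ℓ - δ + 1 → A i j = 0 := fun i j hj =>
      congrFun (congrFun h i) ⟨j, hj⟩
    have hrank : A.rank ≤ δ - 1 := by
      let s : Finset (Fin ℓ) := Finset.univ.filter fun j => ¬ (j : ℕ) < ℓ - δ + 1
      have hs : s.card ≤ δ - 1 := by
        have h1 := Finset.card_filter_add_card_filter_not (s := (Finset.univ : Finset (Fin ℓ)))
          (fun j => (j : ℕ) < ℓ - δ + 1)
        have h2 : (Finset.univ.filter fun j : Fin ℓ => (j : ℕ) < ℓ - δ + 1).card = ℓ - δ + 1 := by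
          rw [Fin.card_filter_val_lt]; omega
        rw [h2, Finset.card_univ, Fintype.card_fin] at h1
        change ℓ - δ + 1 + s.card = ℓ at h1
        omega
      rw [← Matrix.rank_transpose]
      refine (Matrix.rank_le_card_of_support_subset A.transpose s ?_).trans hs
      rw [Function.support_subset_iff']
      intro j hj
      ext i
      exact hzero i j (by simpa [s] using hj)
    have := hmin A hA hA0
    omega
  simpa [Module.finrank_matrix] using LinearMap.finrank_le_finrank_of_injective hφ

/-- Singleton-like bound for rank-metric codes: if every nonzero
matrix of a linear subspace `C ⊆ F_q^{k×ℓ}` has rank at least `δ`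
(with `1 ≤ δ ≤ min{k,ℓ}`), then
`dim C ≤ min{k(ℓ-δ+1), ℓ(k-δ+1)}`. -/
theorem singleton_bound_rank_metric
    {F : Type*} [Field F] [Fintype F] {k ℓ δ : ℕ}
    (hδ1 : 1 ≤ δ) (hδ : δ ≤ min k ℓ)
    (C : Submodule F (Matrix (Fin k) (Fin ℓ) F))
    (hmin : ∀ A ∈ C, A ≠ 0 → δ ≤ A.rank) :
    Module.finrank F C ≤ min (k * (ℓ - δ + 1)) (ℓ * (k - δ + 1)) := by
  refine le_min (finrank_le_of_forall_le_rank hδ1 (hδ.trans (min_le_right _ _)) C hmin) ?_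
  let e := Matrix.transposeLinearEquiv (Fin k) (Fin ℓ) F F
  rw [← LinearEquiv.finrank_map_eq e C]
  refine finrank_le_of_forall_le_rank hδ1 (hδ.trans (min_le_left _ _)) _ ?_
  rintro _ ⟨A, hA, rfl⟩ hne
  have h := hmin A hA fun h0 => hne (by simp [h0])
  rwa [← Matrix.rank_transpose] at h
end

section
/- Let F_q ⊆ F_{q^ℓ} be a finite field extension, let g_1, …, g_k ∈ F_{q^ℓ} be linearly independent over F_q, let 1 ≤ δ ≤ k, and let f(x) = Σ_{i=0}^{k−δ} a_i x^{q^i} be a nonzero q-linearized polynomial with coefficients a_i ∈ F_{q^ℓ}. Then the F_q-span of {f(g_1), …, f(g_k)} inside F_{q^ℓ} has F_q-dimension at least δ. (Equivalently, every nonzero codeword of the Gabidulin code, viewed as a k×ℓ matrix over F_q, has rank at least δ, so Gabidulin codes are MRD.) -/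
open Polynomial in
/-- The polynomial `∑ a_j X^{q^j}` with nonzero coefficient vector is nonzero. -/
theorem linearizedPolynomial_ne_zero {L : Type*} [Field L] {q n : ℕ} (hq : 1 < q)
    {a : Fin n → L} (ha : a ≠ 0) :
    (∑ j, C (a j) * X ^ q ^ (j : ℕ) : L[X]) ≠ 0 := by
  obtain ⟨i, hi⟩ := Function.ne_iff.mp ha
  intro h
  apply hi
  have hc := congrArg (fun p : L[X] => p.coeff (q ^ (i : ℕ))) h
  simp only [finsetSum_coeff, coeff_C_mul, coeff_X_pow, coeff_zero] at hc
  rw [Finset.sum_eq_single i] at hc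
  · simpa using hc
  · intro j _ hji
    rw [if_neg, mul_zero]
    exact fun h => hji (Fin.ext (Nat.pow_right_injective hq h.symm))
  · simp

open Polynomial in
theorem natDegree_linearizedPolynomial_le {L : Type*} [Field L] {q n : ℕ} (hq : 1 < q)
    (a : Fin (n + 1) → L) :
    (∑ j, C (a j) * X ^ q ^ (j : ℕ) : L[X]).natDegree ≤ q ^ n :=
  natDegree_sum_le_of_forall_le _ _ fun j _ =>
    (natDegree_C_mul_X_pow_le _ _).trans (Nat.pow_le_pow_right hq.le (Nat.le_of_lt_succ j.2))

/-- The evaluation of a `q`-linearized polynomial, as a linear map over `F_q`. -/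
noncomputable def linearizedEval (K : Type*) {L : Type*} [Field K] [Fintype K] [Field L]
    [Algebra K L] {n : ℕ} (a : Fin n → L) : L →ₗ[K] L :=
  ∑ j, a j • ((FiniteField.frobeniusAlgHom K L) ^ (j : ℕ)).toLinearMap

theorem linearizedEval_apply {K L : Type*} [Field K] [Fintype K] [Field L]
    [Algebra K L] {n : ℕ} (a : Fin n → L) (x : L) :
    linearizedEval K a x = ∑ j, a j * x ^ Fintype.card K ^ (j : ℕ) := by
  simp [linearizedEval, LinearMap.sum_apply, FiniteField.coe_frobeniusAlgHom, pow_iterate]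

open Polynomial in
/-- The kernel of a nonzero `q`-linearized polynomial of `q`-degree at most `n`
has dimension at most `n`. -/
theorem finrank_ker_linearizedEval_le {K L : Type*} [Field K] [Fintype K] [Field L]
    [Algebra K L] [FiniteDimensional K L] {n : ℕ} {a : Fin (n + 1) → L} (ha : a ≠ 0) :
    Module.finrank K (LinearMap.ker (linearizedEval K a)) ≤ n := by
  classical
  have hq : 1 < Fintype.card K := Fintype.one_lt_card
  have hp := linearizedPolynomial_ne_zero hq ha
  set p : L[X] := ∑ j, C (a j) * X ^ Fintype.card K ^ (j : ℕ) with hpdef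
  have hsub : (LinearMap.ker (linearizedEval K a) : Set L) ⊆ p.roots.toFinset := by
    intro x hx
    have hx' : linearizedEval K a x = 0 := hx
    rw [linearizedEval_apply] at hx'
    rw [Finset.mem_coe, Multiset.mem_toFinset, mem_roots hp, IsRoot.def, hpdef]
    simpa [eval_finsetSum] using hx'
  have hcard : Nat.card (LinearMap.ker (linearizedEval K a)) ≤ Fintype.card K ^ n :=
    calc Nat.card (LinearMap.ker (linearizedEval K a))
        ≤ Nat.card (p.roots.toFinset : Set L) := Nat.card_mono (Finset.finite_toSet _) hsub
      _ = p.roots.toFinset.card := by rw [Nat.card_coe_set_eq, Set.ncard_coe_finset]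
      _ ≤ p.natDegree := (Multiset.toFinset_card_le _).trans (card_roots' p)
      _ ≤ Fintype.card K ^ n := natDegree_linearizedPolynomial_le hq a
  rw [Module.natCard_eq_pow_finrank (K := K), Nat.card_eq_fintype_card] at hcard
  exact (Nat.pow_le_pow_iff_right hq).mp hcard


/-- Gabidulin codes are MRD: let `F_q ⊆ L` be a finite field extension
of degree `ℓ`, `g_1, …, g_k ∈ L` linearly independent over `F_q`, `1 ≤ δ ≤ k`,
and let `f(x) = Σ_{i=0}^{k-δ} a_i x^{q^i}` be a nonzero `q`-linearized polynomial
with coefficients in `L`.  Then the `F_q`-span of `{f(g_1), …, f(g_k)}` has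
`F_q`-dimension at least `δ`, i.e. every nonzero Gabidulin codeword has rank
at least `δ`. -/
theorem gabidulin_codeword_rank_ge
    {K L : Type*} [Field K] [Fintype K] [Field L] [Algebra K L]
    [FiniteDimensional K L] {k δ ℓ : ℕ} (hℓ : Module.finrank K L = ℓ)
    (g : Fin k → L) (hg : LinearIndependent K g)
    (hδ1 : 1 ≤ δ) (hδk : δ ≤ k)
    (a : Fin (k - δ + 1) → L) (ha : a ≠ 0) :
    δ ≤ Module.finrank K (Submodule.span K
      (Set.range fun i : Fin k => ∑ j, a j * g i ^ Fintype.card K ^ (j : ℕ))) := by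
  set W := Submodule.span K (Set.range g)
  set T := linearizedEval K a
  have hspan : Submodule.span K
      (Set.range fun i : Fin k => ∑ j, a j * g i ^ Fintype.card K ^ (j : ℕ)) =
      LinearMap.range (T.domRestrict W) := by
    rw [LinearMap.range_domRestrict, Submodule.map_span, ← Set.range_comp]
    simp only [Function.comp_def, T, linearizedEval_apply]
  have hW : Module.finrank K W = k := by
    simpa using finrank_span_eq_card hg
  have hker : Module.finrank K (LinearMap.ker (T.domRestrict W)) ≤
      Module.finrank K (LinearMap.ker T) := by
    rw [LinearMap.ker_domRestrict]
    exact LinearMap.finrank_le_finrank_of_injective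
      (f := (W.subtype.restrict fun x hx => hx :
        (LinearMap.ker T).comap W.subtype →ₗ[K] LinearMap.ker T))
      fun x y h => Subtype.ext (Subtype.ext (by simpa using congrArg Subtype.val h))
  have hT : Module.finrank K (LinearMap.ker T) ≤ k - δ := finrank_ker_linearizedEval_le ha
  have hrank := LinearMap.finrank_range_add_finrank_ker (T.domRestrict W)
  rw [hspan]
  omega
end

section
/- Let 0 ≤ t ≤ k ≤ n−k and let U_0 = rowspace[I_k 0_{k×(n−k)}] ⊆ F_q^n. For any k-dimensional subspace V = rowspace(V) of F_q^n (V a rank-k k×n matrix), d_S(V, U_0) ≤ 2t if and only if M_{i_1,…,i_k}(V) = 0 for every increasing k-tuple (i_1,…,i_k) that is NOT ≤ (t+1, …, k, n−t+1, …, n) in the Bruhat order. That is, the ball B_{2t}(U_0) of subspace-distance radius 2t around U_0 inside G_q(k,n) is defined by the vanishing of exactly those Plücker coordinates. -/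
/-- The `k × n` matrix `[I_k  0]` (1-indexed pivot in column `i` for row `i`). -/
def idZeroMat (F : Type*) [Field F] (k n : ℕ) : Matrix (Fin k) (Fin n) F :=
  Matrix.of fun i j => if (j : ℕ) = (i : ℕ) then 1 else 0

theorem StrictMono.fin_val_add_sub_le {k n : ℕ} {i : Fin k → Fin n} (hi : StrictMono i)
    {a b : Fin k} (hab : a ≤ b) : (i a : ℕ) + (b - a) ≤ i b := by
  obtain ⟨b, hb⟩ := b
  induction b with
  | zero =>
    obtain rfl : a = ⟨0, hb⟩ := le_antisymm hab (Nat.zero_le _)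
    simp
  | succ b ih =>
    rcases hab.lt_or_eq with h | rfl
    · have h1 : a ≤ ⟨b, by lia⟩ := Nat.lt_succ_iff.mp h
      have h2 := ih (by lia) h1
      have h3 : i ⟨b, by lia⟩ < i ⟨b + 1, hb⟩ := hi (Nat.lt_succ_self b)
      simp only [Fin.lt_def, Fin.le_def] at *
      lia
    · simp

/-- In the Bruhat order, an increasing tuple lies below `(t, …, k - 1, n - t, …, n - 1)` exactly
when at most `t` of its entries are `≥ k`. -/
theorem StrictMono.le_bruhat_iff_card_le {n k t : ℕ} (ht : t ≤ k) {i : Fin k → Fin n}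
    (hi : StrictMono i) :
    (∀ l : Fin k, (i l : ℕ) ≤ (if (l : ℕ) < k - t then t + (l : ℕ) else n - k + (l : ℕ))) ↔
      Fintype.card {l : Fin k // k ≤ (i l : ℕ)} ≤ t := by
  rw [Fintype.card_subtype]
  constructor
  · intro h
    have hsub : ({l | k ≤ (i l : ℕ)} : Finset (Fin k)).map Fin.valEmbedding ⊆
        Finset.Ico (k - t) k := by
      intro x hx
      simp only [Finset.mem_map, Finset.mem_filter, Finset.mem_univ, true_and,
        Fin.valEmbedding_apply] at hx
      obtain ⟨l, hl, rfl⟩ := hx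
      have := h l
      have := l.2
      rw [Finset.mem_Ico]
      split_ifs at * <;> lia
    have := Finset.card_le_card hsub
    rw [Finset.card_map, Nat.card_Ico] at this
    lia
  · intro h l
    have hl := l.2
    split_ifs with hlt
    · by_contra! hgt
      have hsub : Finset.Ici (⟨k - t - 1, by lia⟩ : Fin k) ⊆
          ({l | k ≤ (i l : ℕ)} : Finset (Fin k)) := by
        intro m hm
        rw [Finset.mem_Ici, Fin.le_def] at hm
        have hlm : l ≤ m := Fin.le_def.mpr (by simp only at hm; lia)
        have := hi.fin_val_add_sub_le hlm
        simp only [Finset.mem_filter, Finset.mem_univ, true_and]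
        simp only at hm
        lia
      have := Finset.card_le_card hsub
      rw [Fin.card_Ici] at this
      simp only at this
      lia
    · have h1 := hi.fin_val_add_sub_le (a := l) (b := ⟨k - 1, by lia⟩)
        (Fin.le_def.mpr (by simp only; lia))
      have h2 := (i ⟨k - 1, by lia⟩).2
      simp only at h1
      lia

section

variable {F : Type*} [Field F] {k n : ℕ}

/-- The submatrix of the columns of (zero-based) index at least `k`. -/
def rightBlock (V : Matrix (Fin k) (Fin n) F) :
    Matrix (Fin k) {j : Fin n // k ≤ (j : ℕ)} F :=
  V.submatrix id Subtype.val

theorem rowSpace_eq_range (V : Matrix (Fin k) (Fin n) F) :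
    rowSpace V = LinearMap.range V.vecMulLinear :=
  (range_vecMulLinear V).symm

theorem linearIndependent_row_of_rank {V : Matrix (Fin k) (Fin n) F} (hV : V.rank = k) :
    LinearIndependent F V.row := by
  rw [linearIndependent_iff_card_eq_finrank_span, Set.finrank, ← Matrix.rank_eq_finrank_span_row,
    hV, Fintype.card_fin]

theorem finrank_rowSpace {V : Matrix (Fin k) (Fin n) F} (hV : V.rank = k) :
    Module.finrank F (rowSpace V) = k :=
  (Matrix.rank_eq_finrank_span_row V).symm.trans hV

theorem idZeroMat_row (hkn : k ≤ n) (i : Fin k) :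
    idZeroMat F k n i = Pi.single (Fin.castLE hkn i) 1 := by
  ext j
  simp [idZeroMat, Pi.single_apply, Fin.ext_iff]

theorem finrank_rowSpace_idZeroMat (hkn : k ≤ n) :
    Module.finrank F (rowSpace (idZeroMat F k n)) = k := by
  have hli : LinearIndependent F (fun i : Fin k => idZeroMat F k n i) := by
    simp only [idZeroMat_row hkn]
    exact (Pi.linearIndependent_single_one (Fin n) F).comp _ (Fin.castLE_injective hkn)
  rw [rowSpace, finrank_span_eq_card hli, Fintype.card_fin]

theorem mem_rowSpace_idZeroMat {x : Fin n → F} :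
    x ∈ rowSpace (idZeroMat F k n) ↔ ∀ j : Fin n, k ≤ (j : ℕ) → x j = 0 := by
  constructor
  · intro hx j hj
    have hle : rowSpace (idZeroMat F k n) ≤ LinearMap.ker (LinearMap.proj (R := F) j) := by
      rw [rowSpace, Submodule.span_le]
      rintro _ ⟨i, rfl⟩
      have : (j : ℕ) ≠ i := by have := i.2; lia
      simp [idZeroMat, this]
    exact hle hx
  · intro hx
    rw [pi_eq_sum_univ' x]
    refine Submodule.sum_mem _ fun j _ => ?_
    by_cases hj : k ≤ (j : ℕ)
    · simp [hx j hj]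
    · refine Submodule.smul_mem _ _ (Submodule.subset_span ⟨⟨j, by lia⟩, ?_⟩)
      ext m
      simp [idZeroMat, Pi.single_apply, Fin.ext_iff]

theorem finrank_inf_add_rank_rightBlock {V : Matrix (Fin k) (Fin n) F}
    (hV : V.rank = k) :
    Module.finrank F ↥(rowSpace V ⊓ rowSpace (idZeroMat F k n)) + (rightBlock V).rank = k := by
  have hmap : rowSpace V ⊓ rowSpace (idZeroMat F k n) =
      (LinearMap.ker (rightBlock V).vecMulLinear).map V.vecMulLinear := by
    ext x
    rw [Submodule.mem_inf, mem_rowSpace_idZeroMat, rowSpace_eq_range, Submodule.mem_map]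
    constructor
    · rintro ⟨⟨y, rfl⟩, hy⟩
      exact ⟨y, funext fun j => hy j j.2, rfl⟩
    · rintro ⟨y, hy, rfl⟩
      exact ⟨⟨y, rfl⟩, fun j hj => congrFun hy ⟨j, hj⟩⟩
  have hinj : Function.Injective V.vecMulLinear :=
    Matrix.vecMul_injective_iff.mpr (linearIndependent_row_of_rank hV)
  have hrank : (rightBlock V).rank =
      Module.finrank F (LinearMap.range (rightBlock V).vecMulLinear) := by
    rw [Matrix.rank_eq_finrank_span_row, range_vecMulLinear]
  rw [hmap, ← (Submodule.equivMapOfInjective _ hinj _).finrank_eq, hrank, add_comm,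
    LinearMap.finrank_range_add_finrank_ker, Module.finrank_fin_fun]

theorem sDist_idZeroMat_le_iff (hkn : k ≤ n) {V : Matrix (Fin k) (Fin n) F} (hV : V.rank = k)
    (t : ℕ) :
    sDist (rowSpace V) (rowSpace (idZeroMat F k n)) ≤ 2 * t ↔ (rightBlock V).rank ≤ t := by
  have := finrank_inf_add_rank_rightBlock hV
  rw [sDist, finrank_rowSpace hV, finrank_rowSpace_idZeroMat hkn]
  lia

theorem card_le_rank_rightBlock {V : Matrix (Fin k) (Fin n) F} {i : Fin k → Fin n}
    (hdet : (V.submatrix id i).det ≠ 0) :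
    Fintype.card {l : Fin k // k ≤ (i l : ℕ)} ≤ (rightBlock V).rank := by
  have hli : LinearIndependent F (V.submatrix id i).col :=
    Matrix.linearIndependent_cols_iff_isUnit.mpr
      ((Matrix.isUnit_iff_isUnit_det _).mpr hdet.isUnit)
  have hsub : LinearIndependent F
      (fun l : {l : Fin k // k ≤ (i l : ℕ)} => (V.submatrix id i).col l) :=
    hli.comp _ Subtype.val_injective
  rw [Matrix.rank_eq_finrank_span_cols, ← finrank_span_eq_card hsub]
  refine Submodule.finrank_mono (Submodule.span_mono ?_)
  rintro _ ⟨l, rfl⟩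
  exact ⟨⟨i l, l.2⟩, rfl⟩

theorem exists_det_ne_zero_rank_rightBlock_le {V : Matrix (Fin k) (Fin n) F} (hV : V.rank = k) :
    ∃ i : Fin k → Fin n, StrictMono i ∧ (V.submatrix id i).det ≠ 0 ∧
      (rightBlock V).rank ≤ Fintype.card {l : Fin k // k ≤ (i l : ℕ)} := by
  classical
  obtain ⟨s, hs, -, hspan, hsli⟩ := exists_linearIndepOn_extension
    (linearIndepOn_empty F V.col) (Set.empty_subset {j : Fin n | k ≤ (j : ℕ)})
  obtain ⟨b, -, hsb, hbspan, hbli⟩ := exists_linearIndepOn_extension hsli (Set.subset_univ s)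
  have hcard {u w : Set (Fin n)} (hu : u ⊆ w) (hli : LinearIndepOn F V.col u)
      (hsp : V.col '' w ⊆ Submodule.span F (V.col '' u)) :
      u.toFinset.card = Module.finrank F (Submodule.span F (V.col '' w)) := by
    rw [← le_antisymm (Submodule.span_mono (Set.image_mono hu)) (Submodule.span_le.mpr hsp),
      Set.image_eq_range, finrank_span_eq_card hli, Set.toFinset_card]
  have hbcard : b.toFinset.card = k := by
    rw [hcard (Set.subset_univ b) hbli hbspan, Set.image_univ,
      ← Matrix.rank_eq_finrank_span_cols, hV]
  have hscard : s.toFinset.card = (rightBlock V).rank := by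
    rw [hcard hs hsli hspan, Matrix.rank_eq_finrank_span_cols, Set.image_eq_range]
    rfl
  set e := b.toFinset.orderEmbOfFin hbcard
  have he (l) : e l ∈ b := Set.mem_toFinset.mp (b.toFinset.orderEmbOfFin_mem hbcard l)
  refine ⟨e, e.strictMono, ?_, ?_⟩
  · have hli : LinearIndependent F (V.submatrix id e).col :=
      LinearIndependent.comp hbli (fun l => (⟨e l, he l⟩ : b))
        fun x y h => e.injective (Subtype.mk.inj h)
    exact ((Matrix.isUnit_iff_isUnit_det _).mp
      (Matrix.linearIndependent_cols_iff_isUnit.mp hli)).ne_zero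
  · rw [← hscard, Fintype.card_subtype, ← Finset.card_map e.toEmbedding]
    refine Finset.card_le_card fun j hj => ?_
    have hjs : j ∈ s := Set.mem_toFinset.mp hj
    have hjr : j ∈ Set.range e := by
      rw [Finset.range_orderEmbOfFin]
      simpa using hsb hjs
    obtain ⟨l, rfl⟩ := hjr
    have : k ≤ (e l : ℕ) := hs hjs
    simpa using this

end

/-- the ball of subspace radius `2t` around `U_0 = rowspace [I_k 0]`
is defined in the Plücker embedding by the vanishing of exactly those Plücker
coordinates whose (increasing) index tuple is not `≤ (t+1,…,k,n−t+1,…,n)` in the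
Bruhat order.  (Tuples are `0`-indexed here, so the reference tuple has entries
`t,…,k−1,n−t,…,n−1`.) -/
theorem ball_around_standard_subspace_in_pluecker
    {F : Type*} [Field F] [Fintype F] {n k t : ℕ} (ht : t ≤ k) (hk : k ≤ n - k)
    (V : Matrix (Fin k) (Fin n) F) (hV : V.rank = k) :
    sDist (rowSpace V) (rowSpace (idZeroMat F k n)) ≤ 2 * t ↔
    ∀ i : Fin k → Fin n, StrictMono i →
      ¬ (∀ l : Fin k, (i l : ℕ) ≤
          (if (l : ℕ) < k - t then t + (l : ℕ) else n - k + (l : ℕ))) →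
      (V.submatrix id i).det = 0 := by
  rw [sDist_idZeroMat_le_iff (by lia) hV]
  constructor
  · intro hr i hi hnot
    by_contra hdet
    exact hnot ((hi.le_bruhat_iff_card_le ht).mpr ((card_le_rank_rightBlock hdet).trans hr))
  · intro h
    obtain ⟨i, hi, hdet, hcard⟩ := exists_det_ne_zero_rank_rightBlock_le hV
    by_contra hr
    exact hdet (h i hi fun hle => hr (hcard.trans ((hi.le_bruhat_iff_card_le ht).mp hle)))
end

section
/- Let 0 ≤ e ≤ k ≤ n−k. The number τ of increasing k-tuples (i_1 < … < i_k) from {1,…,n} such that i_l > k for some l ∈ {1,…,k−e} (equivalently, such that the tuple is not ≤ (e+1,…,k,n−e+1,…,n) in the Bruhat order) satisfies τ = Σ_{l=0}^{k−e−1} C(n−k, k−l)·C(k, l) = C(n,k) − Σ_{l=k−e}^{k} C(n−k, k−l)·C(k, l). -/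
open Finset in
/-- The `k`-subsets of a finite type meeting `A` in exactly `l ≤ k` elements. -/
lemma card_filter_powersetCard_inter_eq {α : Type*} [Fintype α] [DecidableEq α] (A : Finset α)
    {k l : ℕ} (hl : l ≤ k) :
    #{s ∈ powersetCard k (univ : Finset α) | #(s ∩ A) = l} =
      (#Aᶜ).choose (k - l) * (#A).choose l := by
  rw [← card_powersetCard, ← card_powersetCard, ← card_product]
  refine card_nbij' (fun s => (s \ A, s ∩ A)) (fun p => p.1 ∪ p.2) ?_ ?_ ?_ ?_
  · intro s hs
    simp only [coe_filter, mem_powersetCard, subset_univ, true_and, Set.mem_ofPred_eq] at hs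
    have := card_sdiff_add_card_inter s A
    simp only [coe_product, Set.mem_prod, mem_coe, mem_powersetCard]
    refine ⟨⟨fun x hx => ?_, by omega⟩, inter_subset_right, hs.2⟩
    simpa using (mem_sdiff.1 hx).2
  · rintro ⟨t, u⟩ h
    simp only [coe_product, Set.mem_prod, mem_coe, mem_powersetCard] at h
    obtain ⟨⟨ht, htc⟩, hu, huc⟩ := h
    have hd : Disjoint t A := subset_compl_iff_disjoint_right.1 ht
    simp only [coe_filter, mem_powersetCard, subset_univ, true_and, Set.mem_ofPred_eq]
    refine ⟨?_, ?_⟩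
    · rw [card_union_of_disjoint (hd.mono_right hu)]
      omega
    · rw [union_inter_distrib_right, disjoint_iff_inter_eq_empty.1 hd, empty_union,
        inter_eq_left.2 hu, huc]
  · intro s _
    exact sdiff_union_inter s A
  · rintro ⟨t, u⟩ h
    simp only [coe_product, Set.mem_prod, mem_coe, mem_powersetCard] at h
    obtain ⟨⟨ht, -⟩, hu, -⟩ := h
    have hd : Disjoint t A := subset_compl_iff_disjoint_right.1 ht
    ext x
    · have := @ht x
      have := @hu x
      simp at *
      tauto
    · have := @ht x
      have := @hu x
      simp at *
      tauto

open Finset in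
/-- An increasing tuple exceeds a bound `b` at one of its first `m` places iff fewer than `m` of its
entries lie below `b`. -/
lemma StrictMono.exists_lt_and_le_iff_card_filter_lt {k m b n : ℕ} {i : Fin k → Fin n}
    (hi : StrictMono i) (hm : m ≤ k) :
    (∃ l : Fin k, (l : ℕ) < m ∧ b ≤ (i l : ℕ)) ↔ #{l | (i l : ℕ) < b} < m := by
  constructor
  · rintro ⟨l, hlm, hl⟩
    refine lt_of_le_of_lt (card_le_card (t := Iio l) fun j hj => ?_) (by simpa using hlm)
    by_contra hjl
    have h : i l ≤ i j := hi.monotone (by simpa using hjl)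
    have hj : (i j : ℕ) < b := by simpa using hj
    have : (i l : ℕ) ≤ i j := h
    omega
  · intro h
    by_contra! hc
    have : #{l : Fin k | (l : ℕ) < m} ≤ #{l | (i l : ℕ) < b} :=
      card_le_card fun j hj => by simpa using hc j (by simpa using hj)
    rw [Fin.card_filter_val_lt] at this
    omega

open Finset in
/-- Increasing tuples correspond to the subsets formed by their entries. -/
lemma ncard_setOf_strictMono_and_card_filter_lt {n k m b : ℕ} :
    Set.ncard {i : Fin k → Fin n | StrictMono i ∧ #{l | (i l : ℕ) < b} < m} =
      #{s ∈ powersetCard k (univ : Finset (Fin n)) |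
        #(s ∩ ({x | (x : ℕ) < b} : Finset (Fin n))) < m} := by
  have hcard {i : Fin k → Fin n} (hi : StrictMono i) :
      #(univ.image i ∩ ({x | (x : ℕ) < b} : Finset (Fin n))) = #{l | (i l : ℕ) < b} := by
    rw [← filter_mem_eq_inter, filter_image, card_image_of_injective _ hi.injective]
    simp
  rw [← Set.ncard_coe_finset]
  refine Set.ncard_congr (fun i _ => univ.image i) ?_ ?_ ?_
  · rintro i ⟨hi, h⟩
    simp only [coe_filter, mem_powersetCard, subset_univ, true_and, Set.mem_ofPred_eq]
    exact ⟨by simp [card_image_of_injective _ hi.injective], by rwa [hcard hi]⟩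
  · rintro i j ⟨hi, -⟩ ⟨hj, -⟩ h
    refine (hi.range_inj hj).1 ?_
    simpa using congrArg (fun s : Finset (Fin n) => (s : Set (Fin n))) h
  · intro s hs
    simp only [coe_filter, mem_powersetCard, subset_univ, true_and, Set.mem_ofPred_eq] at hs
    have himage : univ.image (s.orderEmbOfFin hs.1) = s := by
      simp
    have hmono := (s.orderEmbOfFin hs.1).strictMono
    refine ⟨s.orderEmbOfFin hs.1, ⟨hmono, ?_⟩, himage⟩
    rw [← hcard hmono, himage]
    exact hs.2


/-- Lemma on the number of ball equations: for `0 ≤ e ≤ k ≤ n−k`, the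
number `τ` of increasing `k`-tuples from `{1,…,n}` with `i_l > k` for some
`l ∈ {1,…,k−e}` (equivalently, not `≤ (e+1,…,k,n−e+1,…,n)` in the Bruhat order)
satisfies `τ = Σ_{l=0}^{k−e−1} C(n−k,k−l) C(k,l) = C(n,k) − Σ_{l=k−e}^{k} C(n−k,k−l) C(k,l)`. -/
theorem number_of_ball_equations
    {n k e : ℕ} (he : e ≤ k) (hk : k ≤ n - k) :
    Set.ncard {i : Fin k → Fin n | StrictMono i ∧
        ∃ l : Fin k, (l : ℕ) < k - e ∧ k ≤ (i l : ℕ)}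
      = ∑ l ∈ Finset.range (k - e), Nat.choose (n - k) (k - l) * Nat.choose k l ∧
    Set.ncard {i : Fin k → Fin n | StrictMono i ∧
        ∃ l : Fin k, (l : ℕ) < k - e ∧ k ≤ (i l : ℕ)}
      = Nat.choose n k -
          ∑ l ∈ Finset.Icc (k - e) k, Nat.choose (n - k) (k - l) * Nat.choose k l := by
  have hkn : k ≤ n := by omega
  have hcount : Set.ncard {i : Fin k → Fin n | StrictMono i ∧
      ∃ l : Fin k, (l : ℕ) < k - e ∧ k ≤ (i l : ℕ)}
      = ∑ l ∈ Finset.range (k - e), Nat.choose (n - k) (k - l) * Nat.choose k l := by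
    have hset : {i : Fin k → Fin n | StrictMono i ∧
        ∃ l : Fin k, (l : ℕ) < k - e ∧ k ≤ (i l : ℕ)} =
        {i : Fin k → Fin n | StrictMono i ∧ (Finset.univ.filter fun l => (i l : ℕ) < k).card < k - e} :=
      Set.ext fun i => and_congr_right fun hi =>
        hi.exists_lt_and_le_iff_card_filter_lt (Nat.sub_le k e)
    have hA : (Finset.univ.filter fun x : Fin n => (x : ℕ) < k).card = k := by
      rw [Fin.card_filter_val_lt, min_eq_right hkn]
    rw [hset, ncard_setOf_strictMono_and_card_filter_lt,
      Finset.card_eq_sum_card_fiberwise (t := Finset.range (k - e))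
        (f := fun s => (s ∩ Finset.univ.filter fun x : Fin n => (x : ℕ) < k).card)
        (fun s hs => by simpa using (Finset.mem_filter.1 hs).2)]
    refine Finset.sum_congr rfl fun l hl => ?_
    have hl : l < k - e := Finset.mem_range.1 hl
    have h := card_filter_powersetCard_inter_eq
      (Finset.univ.filter fun x : Fin n => (x : ℕ) < k) (k := k) (l := l) (by omega)
    rw [Finset.card_compl, hA, Fintype.card_fin] at h
    rw [← h, Finset.filter_filter]
    congr 1
    exact Finset.filter_congr fun s _ => ⟨And.right, fun hs => ⟨hs ▸ hl, hs⟩⟩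
  refine ⟨hcount, hcount.trans (Nat.eq_sub_of_add_eq ?_)⟩
  rw [← Finset.Ico_add_one_right_eq_Icc, Finset.sum_range_add_sum_Ico _ (by omega)]
  have h := Nat.add_choose_eq k (n - k) k
  rw [Nat.add_sub_cancel' hkn, Finset.Nat.sum_antidiagonal_eq_sum_range_succ_mk] at h
  rw [h]
  exact Finset.sum_congr rfl fun l _ => mul_comm _ _
end
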